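/- Let γ^S: ℝ^d → ℝ^{m×m} and γ^T: ℝ^k → ℝ^{m×m} be pseudo cross-variograms (with nonnegative entries). Let ν_11,…,ν_mm > 0 and set ν_ij = (ν_ii + ν_jj)/2 for i,j = 1,…,m. Then the matrix-valued function C: ℝ^d × ℝ^k → ℝ^{m×m} with entries C_ij(h,u) = ∫_0^∞ 2^{ν_ij − 1} ω^{ν_ij − 1} exp(−γ^S_ij(h)/(4ω) − (1 + γ^T_ij(u)) ω) dω, i,j = 1,…,m (an integral which equals (γ^S_ij(h)/(1+γ^T_ij(u)))^{ν_ij/2} K_{ν_ij}(√(γ^S_ij(h)(1+γ^T_ij(u)))) in terms of the modified Bessel function of the second kind), is a positive definite matrix-valued function on ℝ^{d+k}. -/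

import Mathlib

open Matrix MeasureTheory Real Set
open scoped BigOperators

/-- A matrix-valued kernel `C : X × X → ℝ^{m×m}` is positive definite if it is symmetric
(`C_ij(x,y) = C_ji(y,x)`) and all quadratic forms `∑_p ∑_q a_pᵀ C(x_p, x_q) a_q` are
nonnegative. -/
def IsPosDefKernel {X : Type*} {m : ℕ} (C : X → X → Matrix (Fin m) (Fin m) ℝ) : Prop :=
  (∀ x y i j, C x y i j = C y x j i) ∧
  ∀ (n : ℕ) (x : Fin n → X) (a : Fin n → Fin m → ℝ),
    0 ≤ ∑ p, ∑ q, a p ⬝ᵥ (C (x p) (x q)).mulVec (a q)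

/-- A matrix-valued kernel `Γ : X × X → ℝ^{m×m}` is conditionally negative definite if it is
symmetric (`Γ_ij(x,y) = Γ_ji(y,x)`) and all quadratic forms `∑_p ∑_q a_pᵀ Γ(x_p, x_q) a_q`
with `1_mᵀ ∑_p a_p = 0` are nonpositive. -/
def IsCondNegDefKernel {X : Type*} {m : ℕ} (Γ : X → X → Matrix (Fin m) (Fin m) ℝ) : Prop :=
  (∀ x y i j, Γ x y i j = Γ y x j i) ∧
  ∀ (n : ℕ) (x : Fin n → X) (a : Fin n → Fin m → ℝ),
    (∑ p, ∑ i, a p i) = 0 →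
    ∑ p, ∑ q, a p ⬝ᵥ (Γ (x p) (x q)).mulVec (a q) ≤ 0

/-- A non-stationary pseudo cross-variogram: a conditionally negative definite matrix-valued
kernel vanishing on the diagonal of its diagonal components. -/
def IsNSPseudoCrossVariogram {X : Type*} {m : ℕ}
    (Γ : X → X → Matrix (Fin m) (Fin m) ℝ) : Prop :=
  IsCondNegDefKernel Γ ∧ ∀ x i, Γ x x i i = 0

/-- A matrix-valued function is positive definite if the associated translation-invariant
kernel `(x, y) ↦ C (x - y)` is a positive definite kernel. -/
def IsPosDefFun {V : Type*} [AddCommGroup V] {m : ℕ}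
    (C : V → Matrix (Fin m) (Fin m) ℝ) : Prop :=
  IsPosDefKernel (fun x y => C (x - y))

/-- A (stationary) pseudo cross-variogram: the kernel `(x,y) ↦ γ(x−y)` is conditionally
negative definite and `γ_ii(0) = 0` for all `i`. -/
def IsPseudoCrossVariogram {V : Type*} [AddCommGroup V] {m : ℕ}
    (γ : V → Matrix (Fin m) (Fin m) ℝ) : Prop :=
  IsCondNegDefKernel (fun x y => γ (x - y)) ∧ ∀ i, γ 0 i i = 0

/-- Entrywise powers of a real positive semidefinite matrix are positive semidefinite. -/
lemma Matrix.PosSemidef.entrywise_pow {ι : Type*} [Finite ι] {A : Matrix ι ι ℝ}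
    (hA : A.PosSemidef) (k : ℕ) : (Matrix.of fun s t => A s t ^ k).PosSemidef := by
  induction k with
  | zero =>
    have h : (Matrix.of fun s t => A s t ^ 0) =
        vecMulVec (fun _ : ι => (1 : ℝ)) (star fun _ => 1) := by
      ext s t
      simp [vecMulVec_apply]
    rw [h]
    exact posSemidef_vecMulVec_self_star _
  | succ k ih =>
    have h : (Matrix.of fun s t => A s t ^ (k + 1)) = (Matrix.of fun s t => A s t ^ k) ⊙ A := by
      ext s t
      simp [pow_succ]
    rw [h]
    exact ih.hadamard hA

/-- The quadratic form of a real positive semidefinite matrix, written as a double sum. -/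
lemma Matrix.PosSemidef.sum_nonneg {ι : Type*} [Fintype ι] {A : Matrix ι ι ℝ}
    (hA : A.PosSemidef) (b : ι → ℝ) : 0 ≤ ∑ s, ∑ t, b s * A s t * b t := by
  have h := hA.dotProduct_mulVec_nonneg b
  simpa [dotProduct, mulVec, Finset.mul_sum, mul_assoc] using h

/-- The quadratic form of the entrywise exponential of a real positive semidefinite matrix is
nonnegative. -/
lemma Matrix.PosSemidef.sum_exp_nonneg {ι : Type*} [Fintype ι] {A : Matrix ι ι ℝ}
    (hA : A.PosSemidef) (b : ι → ℝ) : 0 ≤ ∑ s, ∑ t, b s * Real.exp (A s t) * b t := by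
  have h : HasSum (fun k : ℕ => ∑ s, ∑ t, b s * (A s t ^ k / k.factorial) * b t)
      (∑ s, ∑ t, b s * Real.exp (A s t) * b t) := by
    refine hasSum_sum fun s _ => hasSum_sum fun t _ => ?_
    rw [Real.exp_eq_exp_ℝ]
    exact ((NormedSpace.expSeries_div_hasSum_exp (A s t)).mul_left (b s)).mul_right (b t)
  refine h.nonneg fun k => ?_
  have hk := (hA.entrywise_pow k).sum_nonneg b
  have hd : ∑ s, ∑ t, b s * (A s t ^ k / k.factorial) * b t =
      (∑ s, ∑ t, b s * A s t ^ k * b t) / k.factorial := by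
    simp only [Finset.sum_div]
    exact Finset.sum_congr rfl fun s _ => Finset.sum_congr rfl fun t _ => by ring
  rw [hd]
  exact div_nonneg hk (by positivity)

/-- **Schoenberg's theorem**: if `G` is symmetric and conditionally negative definite, then
the entrywise exponential of `-G` has a nonnegative quadratic form. -/
lemma sum_exp_neg_nonneg_of_condNegDef {ι : Type*} [Fintype ι] {G : ι → ι → ℝ}
    (hsymm : ∀ s t, G s t = G t s)
    (hG : ∀ b : ι → ℝ, ∑ s, b s = 0 → ∑ s, ∑ t, b s * G s t * b t ≤ 0) (b : ι → ℝ) :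
    0 ≤ ∑ s, ∑ t, b s * Real.exp (-G s t) * b t := by
  classical
  rcases isEmpty_or_nonempty ι with hι | ⟨⟨r⟩⟩
  · simp
  have hA : (Matrix.of fun s t => G s r + G r t - G s t - G r r).PosSemidef := by
    refine .of_dotProduct_mulVec_nonneg ?_ fun c => ?_
    · ext s t
      simp only [conjTranspose_apply, of_apply, star_trivial]
      rw [hsymm t r, hsymm r s, hsymm t s]
      ring
    · have h := hG (fun s => c s - if s = r then ∑ t, c t else 0) (by simp)
      have e : ∑ s, ∑ t, (c s - if s = r then ∑ t, c t else 0) * G s t *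
          (c t - if t = r then ∑ t, c t else 0) =
          -(star c ⬝ᵥ (Matrix.of fun s t => G s r + G r t - G s t - G r r) *ᵥ c) := by
        set S := ∑ t, c t with hS
        have e1 : star c ⬝ᵥ (Matrix.of fun s t => G s r + G r t - G s t - G r r) *ᵥ c =
            (∑ s, c s * G s r) * S + S * (∑ t, G r t * c t) - (∑ s, ∑ t, c s * G s t * c t)
              - S * S * G r r := by
          simp only [dotProduct, mulVec, of_apply, star_trivial, hS, Finset.sum_mul_sum]
          simp only [Finset.mul_sum, Finset.sum_mul, ← Finset.sum_sub_distrib,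
            ← Finset.sum_add_distrib]
          refine Finset.sum_congr rfl fun s _ => ?_
          refine Finset.sum_congr rfl fun t _ => ?_
          ring
        rw [e1]
        simp only [sub_mul, mul_sub, Finset.sum_sub_distrib, ite_mul, mul_ite, zero_mul, mul_zero,
          Finset.sum_ite_eq', Finset.mem_univ, if_true, ← Finset.sum_mul]
        simp only [Finset.sum_ite_irrel, Finset.sum_const_zero, Finset.sum_ite_eq',
          Finset.mem_univ, if_true, mul_assoc, ← Finset.mul_sum]
        ring
      linarith
  have h := hA.sum_exp_nonneg fun s => b s * Real.exp (-G s r + G r r / 2)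
  refine h.trans_eq (Finset.sum_congr rfl fun s _ => Finset.sum_congr rfl fun t _ => ?_)
  have he : Real.exp (-G s t) = Real.exp (-G s r + G r r / 2) *
      Real.exp (G s r + G r t - G s t - G r r) * Real.exp (-G t r + G r r / 2) := by
    rw [← Real.exp_add, ← Real.exp_add, hsymm t r]
    congr 1
    ring
  rw [he, of_apply]
  ring

/-- A double sum of matrix-valued quadratic forms as a single quadratic form over pairs. -/
lemma sum_dotProduct_mulVec_eq_sum_prod {n m : ℕ}
    (M : Fin n → Fin n → Matrix (Fin m) (Fin m) ℝ) (a : Fin n → Fin m → ℝ) :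
    ∑ p, ∑ q, a p ⬝ᵥ (M p q).mulVec (a q) =
      ∑ s : Fin n × Fin m, ∑ t : Fin n × Fin m,
        a s.1 s.2 * M s.1 t.1 s.2 t.2 * a t.1 t.2 := by
  simp only [Fintype.sum_prod_type, dotProduct, mulVec, Finset.mul_sum, mul_assoc]
  exact Finset.sum_congr rfl fun p _ => Finset.sum_comm

lemma IsCondNegDefKernel.sum_prod_nonpos {X : Type*} {m n : ℕ}
    {Γ : X → X → Matrix (Fin m) (Fin m) ℝ} (hΓ : IsCondNegDefKernel Γ) (x : Fin n → X)
    (b : Fin n × Fin m → ℝ) (hb : ∑ s, b s = 0) :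
    ∑ s, ∑ t, b s * Γ (x s.1) (x t.1) s.2 t.2 * b t ≤ 0 := by
  have h := hΓ.2 n x (fun p i => b (p, i)) (by rwa [Fintype.sum_prod_type] at hb)
  rwa [sum_dotProduct_mulVec_eq_sum_prod (fun p q => Γ (x p) (x q))] at h

/-- The Matérn mixture integrand is integrable. -/
lemma integrableOn_matern_mixture {σ τ κ : ℝ} (hσ : 0 ≤ σ) (hτ : 0 ≤ τ) (hκ : 0 < κ) :
    IntegrableOn (fun ω : ℝ => (2:ℝ) ^ (κ - 1) * ω ^ (κ - 1) *
      Real.exp (-σ / (4 * ω) - (1 + τ) * ω)) (Ioi 0) := by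
  refine Integrable.mono' ((Real.GammaIntegral_convergent hκ).const_mul ((2:ℝ) ^ (κ - 1)))
    (by fun_prop) ?_
  refine (ae_restrict_iff' measurableSet_Ioi).2 (.of_forall fun ω (hω : 0 < ω) => ?_)
  have h1 : 0 ≤ σ / (4 * ω) := by positivity
  have h2 : 0 ≤ τ * ω := by positivity
  have h3 : Real.exp (-σ / (4 * ω) - (1 + τ) * ω) ≤ Real.exp (-ω) := by
    apply Real.exp_le_exp.2
    rw [neg_div]
    linarith
  rw [Real.norm_of_nonneg (by positivity)]
  calc _ ≤ (2:ℝ) ^ (κ - 1) * ω ^ (κ - 1) * Real.exp (-ω) := by gcongr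
    _ = _ := by ring

/-- Matérn-type mixture. For pseudo cross-variograms `γ^S`, `γ^T` with
nonnegative entries and `ν_ij = (ν_ii + ν_jj)/2` with `ν_ii > 0`, the function with entries
`C_ij(h,u) = ∫_0^∞ 2^{ν_ij−1} ω^{ν_ij−1} exp(−γ^S_ij(h)/(4ω) − (1 + γ^T_ij(u))ω) dω` is a
positive definite matrix-valued function on `ℝ^d × ℝ^k`. -/
theorem matern_mixture_posdef {d k m : ℕ}
    (γS : (Fin d → ℝ) → Matrix (Fin m) (Fin m) ℝ)
    (γT : (Fin k → ℝ) → Matrix (Fin m) (Fin m) ℝ)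
    (hS : IsPseudoCrossVariogram γS) (hSnn : ∀ h i j, 0 ≤ γS h i j)
    (hT : IsPseudoCrossVariogram γT) (hTnn : ∀ u i j, 0 ≤ γT u i j)
    (ν : Fin m → ℝ) (hν : ∀ i, 0 < ν i) :
    IsPosDefFun (fun hu : (Fin d → ℝ) × (Fin k → ℝ) => Matrix.of fun i j =>
      ∫ ω in Ioi (0:ℝ),
        (2:ℝ) ^ ((ν i + ν j) / 2 - 1) * ω ^ ((ν i + ν j) / 2 - 1) *
          Real.exp (-(γS hu.1 i j) / (4 * ω) - (1 + γT hu.2 i j) * ω)) := by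
  refine ⟨fun x y i j => ?_, fun n x a => ?_⟩
  · have h1 := hS.1.1 x.1 y.1 i j
    have h2 := hT.1.1 x.2 y.2 i j
    simp only [of_apply, Prod.fst_sub, Prod.snd_sub, h1, h2, add_comm (ν i)]
  rw [sum_dotProduct_mulVec_eq_sum_prod]
  simp only [of_apply]
  have hint (s t : Fin n × Fin m) := integrableOn_matern_mixture
    (hSnn (x s.1 - x t.1).1 s.2 t.2) (hTnn (x s.1 - x t.1).2 s.2 t.2)
    (half_pos (add_pos (hν s.2) (hν t.2)))
  simp only [← integral_const_mul, ← integral_mul_const]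
  have hint' (s t : Fin n × Fin m) := ((hint s t).const_mul (a s.1 s.2)).mul_const (a t.1 t.2)
  have hsum (s : Fin n × Fin m) := integral_finsetSum Finset.univ fun t _ => hint' s t
  simp only [← hsum]
  rw [← integral_finsetSum _ fun s _ => integrable_finsetSum _ fun t _ => hint' s t]
  refine setIntegral_nonneg measurableSet_Ioi fun ω (hω : 0 < ω) => ?_
  let G (s t : Fin n × Fin m) : ℝ := γS (x s.1 - x t.1).1 s.2 t.2 / (4 * ω) +
    (1 + γT (x s.1 - x t.1).2 s.2 t.2) * ω
  have h := sum_exp_neg_nonneg_of_condNegDef (G := G) (fun s t => ?_) (fun b hb => ?_)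
    fun s => a s.1 s.2 * (2 * ω) ^ ((ν s.2 - 1) / 2)
  · refine h.trans_eq (Finset.sum_congr rfl fun s _ => Finset.sum_congr rfl fun t _ => ?_)
    have he : (2:ℝ) ^ ((ν s.2 + ν t.2) / 2 - 1) * ω ^ ((ν s.2 + ν t.2) / 2 - 1) =
        (2 * ω) ^ ((ν s.2 - 1) / 2) * (2 * ω) ^ ((ν t.2 - 1) / 2) := by
      rw [← Real.mul_rpow two_pos.le hω.le, ← Real.rpow_add (by positivity)]
      congr 1
      ring
    rw [he, neg_div, ← neg_add']
    ring
  · have h1 := hS.1.1 (x s.1).1 (x t.1).1 s.2 t.2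
    have h2 := hT.1.1 (x s.1).2 (x t.1).2 s.2 t.2
    simp only [G, Prod.fst_sub, Prod.snd_sub, h1, h2]
  · have h1 := hS.1.sum_prod_nonpos (fun p => (x p).1) b hb
    have h2 := hT.1.sum_prod_nonpos (fun p => (x p).2) b hb
    have h3 : ∑ s, ∑ t, b s * b t = 0 := by rw [← Finset.sum_mul_sum, hb, zero_mul]
    have e : ∑ s, ∑ t, b s * G s t * b t =
        (∑ s, ∑ t, b s * γS ((x s.1).1 - (x t.1).1) s.2 t.2 * b t) / (4 * ω) +
        (∑ s, ∑ t, b s * γT ((x s.1).2 - (x t.1).2) s.2 t.2 * b t) * ω +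
        (∑ s, ∑ t, b s * b t) * ω := by
      simp only [Finset.sum_div, Finset.sum_mul, ← Finset.sum_add_distrib]
      refine Finset.sum_congr rfl fun s _ => Finset.sum_congr rfl fun t _ => ?_
      simp only [G, Prod.fst_sub, Prod.snd_sub]
      ring
    rw [e, h3, zero_mul, add_zero]
    exact add_nonpos (div_nonpos_of_nonpos_of_nonneg h1 (by positivity))
      (mul_nonpos_of_nonpos_of_nonneg h2 hω.le)
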